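/- Let p ∈ {3,4,5,6} and T = 2p+1. For Lebesgue-almost every tuple of nine complex matrices (H̄_{j,i})_{j,i ∈ {1,2,3}} with H̄_{j,i} ∈ ℂ^{(p+1)×p}, the following holds. Let H_{j,i} ∈ ℝ^{2T(p+1)×2Tp} be the real block matrix whose (q,r)-th 2T×2T block is C_T(H̄_{j,i}(q,r)) for q ∈ {1,…,p+1}, r ∈ {1,…,p}. Then there exist matrices V_1, V_2, V_3 ∈ ℝ^{2Tp×2p(p+1)} and W_1, W_2, W_3 ∈ ℝ^{2p(p+1)×2T(p+1)} such that W_j·H_{j,i}·V_i = 0 for all i ≠ j and W_j·H_{j,j}·V_j is invertible for every j ∈ {1,2,3}. -/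

import Mathlib

open Matrix MeasureTheory

/-- The ACS extension of a complex number `h` with `T` symbol extensions in time:
`C_T(h) = I_T ⊗ [[Re h, −Im h], [Im h, Re h]] ∈ ℝ^{2T×2T}`. -/
noncomputable def Cmat (T : ℕ) (h : ℂ) : Matrix (Fin (2 * T)) (Fin (2 * T)) ℝ :=
  Matrix.of fun i j =>
    if (i : ℕ) / 2 = (j : ℕ) / 2 then
      !![h.re, -h.im; h.im, h.re] ⟨(i : ℕ) % 2, Nat.mod_lt _ (by norm_num)⟩
        ⟨(j : ℕ) % 2, Nat.mod_lt _ (by norm_num)⟩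
    else 0

/-- Assemble an `R×C` block matrix with `m×n` blocks into a full `(R*m)×(C*n)` matrix. -/
noncomputable def blk {α : Type*} {R C m n : ℕ}
    (f : Fin R → Fin C → Matrix (Fin m) (Fin n) α) :
    Matrix (Fin (R * m)) (Fin (C * n)) α :=
  Matrix.of fun i j =>
    f ⟨(i : ℕ) / m, Nat.div_lt_of_lt_mul (Nat.mul_comm R m ▸ i.2)⟩
      ⟨(j : ℕ) / n, Nat.div_lt_of_lt_mul (Nat.mul_comm C n ▸ j.2)⟩
      ⟨(i : ℕ) % m, Nat.mod_lt _ (by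
        rcases Nat.eq_zero_or_pos m with hm | hm
        · subst hm; exact absurd i.2 (by omega)
        · exact hm)⟩
      ⟨(j : ℕ) % n, Nat.mod_lt _ (by
        rcases Nat.eq_zero_or_pos n with hn | hn
        · subst hn; exact absurd j.2 (by omega)
        · exact hn)⟩

/-- The extended real channel from transmitter `i` to receiver `j` in the (p,p+1) case with
`T = 2p+1`: the `2T(p+1) × 2Tp` real block matrix whose `(q,r)`-th `2T×2T` block is
`C_T(H̄_{j,i}(q,r))`. -/
noncomputable def Hext (p : ℕ) (H : Fin 3 → Fin 3 → Fin (p + 1) → Fin p → ℂ) (j i : Fin 3) :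
    Matrix (Fin ((p + 1) * (2 * (2 * p + 1)))) (Fin (p * (2 * (2 * p + 1)))) ℝ :=
  blk fun q r => Cmat (2 * p + 1) (H j i q r)

/-- A continuous complex function on a real topological vector space whose restriction to
every affine line is a polynomial in the line parameter. -/
def IsLinePoly {E : Type*} [TopologicalSpace E] [AddCommGroup E] [Module ℝ E] (f : E → ℂ) : Prop :=
  Continuous f ∧ ∀ a b : E, ∃ q : Polynomial ℂ, ∀ t : ℝ, f (a + t • b) = q.eval (t : ℂ)

namespace IsLinePoly

section Closure

variable {E : Type*} [TopologicalSpace E] [AddCommGroup E] [Module ℝ E] {f g : E → ℂ}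

theorem const (c : ℂ) : IsLinePoly fun _ : E => c :=
  ⟨continuous_const, fun _ _ => ⟨Polynomial.C c, fun _ => by simp⟩⟩

theorem add (hf : IsLinePoly f) (hg : IsLinePoly g) : IsLinePoly fun x => f x + g x := by
  refine ⟨hf.1.add hg.1, fun a b => ?_⟩
  obtain ⟨q, hq⟩ := hf.2 a b
  obtain ⟨r, hr⟩ := hg.2 a b
  exact ⟨q + r, fun t => by simp [hq, hr]⟩

theorem mul (hf : IsLinePoly f) (hg : IsLinePoly g) : IsLinePoly fun x => f x * g x := by
  refine ⟨hf.1.mul hg.1, fun a b => ?_⟩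
  obtain ⟨q, hq⟩ := hf.2 a b
  obtain ⟨r, hr⟩ := hg.2 a b
  exact ⟨q * r, fun t => by simp [hq, hr]⟩

theorem neg (hf : IsLinePoly f) : IsLinePoly fun x => -f x := by
  simpa using (const (-1)).mul hf

theorem sub (hf : IsLinePoly f) (hg : IsLinePoly g) : IsLinePoly fun x => f x - g x := by
  simpa [sub_eq_add_neg] using hf.add hg.neg

theorem star (hf : IsLinePoly f) : IsLinePoly fun x => starRingEnd ℂ (f x) := by
  refine ⟨Complex.continuous_conj.comp hf.1, fun a b => ?_⟩
  obtain ⟨q, hq⟩ := hf.2 a b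
  refine ⟨q.map (starRingEnd ℂ), fun t => ?_⟩
  dsimp only
  rw [hq, Polynomial.eval_map, ← Complex.conj_ofReal t, Polynomial.eval₂_hom, Complex.conj_ofReal]

theorem re (hf : IsLinePoly f) : IsLinePoly fun x => ((f x).re : ℂ) := by
  simpa [Complex.re_eq_add_conj, div_eq_mul_inv] using (hf.add hf.star).mul (const 2⁻¹)

theorem im (hf : IsLinePoly f) : IsLinePoly fun x => ((f x).im : ℂ) := by
  simpa [Complex.im_eq_sub_conj, div_eq_mul_inv] using (hf.sub hf.star).mul (const (2 * Complex.I)⁻¹)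

theorem sum {ι : Type*} {f : ι → E → ℂ} (s : Finset ι) (hf : ∀ i ∈ s, IsLinePoly (f i)) :
    IsLinePoly fun x => ∑ i ∈ s, f i x := by
  classical
  induction s using Finset.induction_on with
  | empty => simpa using const 0
  | insert a s ha ih =>
    simp only [Finset.sum_insert ha]
    exact (hf a (by simp)).add (ih fun i hi => hf i (by simp [hi]))

theorem prod {ι : Type*} {f : ι → E → ℂ} (s : Finset ι) (hf : ∀ i ∈ s, IsLinePoly (f i)) :
    IsLinePoly fun x => ∏ i ∈ s, f i x := by
  classical
  induction s using Finset.induction_on with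
  | empty => simpa using const 1
  | insert a s ha ih =>
    simp only [Finset.prod_insert ha]
    exact (hf a (by simp)).mul (ih fun i hi => hf i (by simp [hi]))

theorem det {m : Type*} [Fintype m] [DecidableEq m] {M : E → Matrix m m ℂ}
    (hM : ∀ i j, IsLinePoly fun x => M x i j) : IsLinePoly fun x => (M x).det := by
  simp only [Matrix.det_apply']
  exact sum _ fun σ _ => (const _).mul (prod _ fun i _ => hM _ _)

theorem adjugate {m : Type*} [Fintype m] [DecidableEq m] {M : E → Matrix m m ℂ}
    (hM : ∀ i j, IsLinePoly fun x => M x i j) (i j : m) :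
    IsLinePoly fun x => (M x).adjugate i j := by
  simp only [Matrix.adjugate_apply]
  refine det fun k l => ?_
  by_cases h : k = j
  · subst h
    simpa using const _
  · simpa [Matrix.updateRow_ne h] using hM k l

theorem matrix_mul {l m n : Type*} [Fintype m] {M : E → Matrix l m ℂ} {N : E → Matrix m n ℂ}
    (hM : ∀ i j, IsLinePoly fun x => M x i j) (hN : ∀ i j, IsLinePoly fun x => N x i j)
    (i : l) (j : n) : IsLinePoly fun x => (M x * N x) i j := by
  simp only [Matrix.mul_apply]
  exact sum _ fun k _ => (hM i k).mul (hN k j)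

theorem mulVec {m n : Type*} [Fintype n] {M : E → Matrix m n ℂ} {v : E → n → ℂ}
    (hM : ∀ i j, IsLinePoly fun x => M x i j) (hv : ∀ j, IsLinePoly fun x => v x j) (i : m) :
    IsLinePoly fun x => (M x *ᵥ v x) i := by
  simp only [Matrix.mulVec, dotProduct]
  exact sum _ fun k _ => (hM i k).mul (hv k)

end Closure

theorem of_clm {E : Type*} [NormedAddCommGroup E] [NormedSpace ℝ E] (L : E →L[ℝ] ℂ) :
    IsLinePoly L :=
  ⟨L.continuous, fun a b => ⟨Polynomial.C (L a) + Polynomial.C (L b) * Polynomial.X,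
    fun t => by simp [mul_comm (t : ℂ)]⟩⟩

/-- A function which is polynomial along lines and does not vanish identically is nonzero
almost everywhere. -/
theorem ae_ne_zero {E : Type*} [NormedAddCommGroup E] [NormedSpace ℝ E] [FiniteDimensional ℝ E]
    [MeasurableSpace E] [BorelSpace E] (μ : Measure E) [μ.IsAddHaarMeasure] {f : E → ℂ}
    (hf : IsLinePoly f) {a : E} (ha : f a ≠ 0) : ∀ᵐ x ∂μ, f x ≠ 0 := by
  have : SecondCountableTopology E := secondCountable_of_proper
  have hline : ∀ b : E, ∀ᵐ t : ℝ, f (a + t • b) ≠ 0 := by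
    intro b
    obtain ⟨q, hq⟩ := hf.2 a b
    have hq0 : q ≠ 0 := by
      rintro rfl
      exact ha (by simpa using hq 0)
    have hfin : {t : ℝ | q.IsRoot (t : ℂ)}.Finite :=
      (q.finite_setOfPred_isRoot hq0).preimage Complex.ofReal_injective.injOn
    refine ae_iff.2 (measure_mono_null ?_ (hfin.measure_zero volume))
    intro t ht
    simpa [hq] using ht
  have hmeas : MeasurableSet {z : E × ℝ | f (a + z.2 • z.1) ≠ 0} :=
    (isOpen_ne.preimage (hf.1.comp (by fun_prop : Continuous fun z : E × ℝ => a + z.2 • z.1)))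
      |>.measurableSet
  have hprod : ∀ᵐ z ∂μ.prod (volume : Measure ℝ), f (a + z.2 • z.1) ≠ 0 :=
    (Measure.ae_prod_iff_ae_ae hmeas).2 (Filter.Eventually.of_forall hline)
  have hswap : ∀ᵐ t : ℝ, ∀ᵐ b ∂μ, f (a + t • b) ≠ 0 :=
    Measure.ae_ae_comm hmeas |>.1 (Measure.ae_ae_of_ae_prod hprod)
  obtain ⟨t, ht, ht0⟩ := (hswap.and (Measure.ae_ne volume (0 : ℝ))).exists
  have h1 : μ ((fun x => t • x) ⁻¹' ((fun x => a + x) ⁻¹' {x | f x = 0})) = 0 := by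
    simpa [ae_iff] using ht
  rw [Measure.addHaar_preimage_smul μ ht0, measure_preimage_add] at h1
  have h2 : ENNReal.ofReal |(t ^ Module.finrank ℝ E)⁻¹| ≠ 0 := by
    simp [ht0]
  simpa [ae_iff] using (mul_eq_zero.1 h1).resolve_left h2

end IsLinePoly

namespace MIMO

/-- The nine complex channel matrices of the 3-user interference channel. -/
abbrev Channel (p : ℕ) := Fin 3 → Fin 3 → Fin (p + 1) → Fin p → ℂ

/-- An index set for the `2p+1` symbol extensions. -/
abbrev Slot (p : ℕ) := Option (Fin p × Bool)

/-- The complex coefficient vectors carried by the three families of alignment chains. -/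
abbrev Coeffs (p : ℕ) := Fin 3 → Option (Slot p) → Slot p → ℂ

section Kernel

variable {m n : Type*} [Fintype m] [DecidableEq m] [Fintype n]

/-- A multiple of the orthogonal projection of `v` to the kernel of `A`, polynomial in the entries
of `A` and their conjugates. -/
noncomputable def kerVec (A : Matrix m n ℂ) (v : n → ℂ) : n → ℂ :=
  (A * Aᴴ).det • v - Aᴴ *ᵥ ((A * Aᴴ).adjugate *ᵥ (A *ᵥ v))

theorem mulVec_kerVec (A : Matrix m n ℂ) (v : n → ℂ) : A *ᵥ kerVec A v = 0 := by
  rw [kerVec, Matrix.mulVec_sub, Matrix.mulVec_mulVec, Matrix.mulVec_mulVec, Matrix.mul_adjugate,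
    Matrix.mulVec_smul, Matrix.smul_mulVec, Matrix.one_mulVec, sub_self]

theorem kerVec_of_mulVec_eq_zero {A : Matrix m n ℂ} {v : n → ℂ} (h : A *ᵥ v = 0) :
    kerVec A v = (A * Aᴴ).det • v := by
  simp [kerVec, h]

end Kernel

variable {n : ℕ}

/-- The linear system for the alignment chain started at transmitter `s`: its `k`-th vector is
sent by transmitter `s + k` and aligned with the next one at receiver `s + k + 2`. -/
noncomputable def chainMat (H : Channel (n + 1)) (s : Fin 3) :
    Matrix (Fin n × Fin (n + 2)) (Fin (n + 1) × Fin (n + 1)) ℂ :=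
  Matrix.of fun a b =>
    (if b.1 = a.1.castSucc then
      H (s + Fin.ofNat 3 a.1 + 2) (s + Fin.ofNat 3 a.1) a.2 b.2 else 0) -
    if b.1 = a.1.succ then
      H (s + Fin.ofNat 3 a.1 + 2) (s + Fin.ofNat 3 a.1 + 1) a.2 b.2 else 0

theorem chainMat_mulVec (H : Channel (n + 1)) (s : Fin 3) (x : Fin (n + 1) × Fin (n + 1) → ℂ)
    (k : Fin n) (q : Fin (n + 2)) :
    (chainMat H s *ᵥ x) (k, q) =
      ∑ r, H (s + Fin.ofNat 3 k + 2) (s + Fin.ofNat 3 k) q r * x (k.castSucc, r) -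
      ∑ r, H (s + Fin.ofNat 3 k + 2) (s + Fin.ofNat 3 k + 1) q r * x (k.succ, r) := by
  simp only [Matrix.mulVec, dotProduct, chainMat, Matrix.of_apply, Fintype.sum_prod_type, sub_mul,
    ite_mul, zero_mul, Finset.sum_sub_distrib]
  congr 1
  · rw [Finset.sum_eq_single k.castSucc (fun b _ hb => by simp [hb]) (by simp)]
    simp
  · rw [Finset.sum_eq_single k.succ (fun b _ hb => by simp [hb]) (by simp)]
    simp

theorem add_two_sub_succ {m : ℕ} (j : Fin 3) (k : Fin m) :
    j + 2 - Fin.ofNat 3 (k.succ : ℕ) = j + 1 - Fin.ofNat 3 (k : ℕ) := by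
  rw [Fin.val_succ]
  grind

/-- The chain vector in position `k` sent by transmitter `i`. -/
noncomputable def chainVec (H : Channel (n + 1)) (i : Fin 3) (k r : Fin (n + 1)) : ℂ :=
  kerVec (chainMat H (i - Fin.ofNat 3 k)) (fun b => if b.1 = b.2 then 1 else 0) (k, r)

theorem chainVec_align (H : Channel (n + 1)) (j : Fin 3) (k : Fin n) :
    Matrix.of (H j (j + 1)) *ᵥ chainVec H (j + 1) k.castSucc =
      Matrix.of (H j (j + 2)) *ᵥ chainVec H (j + 2) k.succ := by
  ext q
  have h := congrFun (mulVec_kerVec (chainMat H (j + 1 - Fin.ofNat 3 k))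
    (fun b => if b.1 = b.2 then 1 else 0)) (k, q)
  have e1 : j + 1 - Fin.ofNat 3 (k : ℕ) + Fin.ofNat 3 (k : ℕ) + 2 = j := by grind
  have e2 : j + 1 - Fin.ofNat 3 (k : ℕ) + Fin.ofNat 3 (k : ℕ) = j + 1 := by grind
  have e3 : j + 1 - Fin.ofNat 3 (k : ℕ) + Fin.ofNat 3 (k : ℕ) + 1 = j + 2 := by grind
  have e4 : j + 2 - Fin.ofNat 3 ((k.succ : Fin (n + 1)) : ℕ) = j + 1 - Fin.ofNat 3 (k : ℕ) :=
    add_two_sub_succ j k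
  rw [chainMat_mulVec, e1, e3, e2, Pi.zero_apply, sub_eq_zero] at h
  simp only [Matrix.mulVec, dotProduct, Matrix.of_apply, chainVec, e4]
  exact h

/-- The vectors spanning the aligned interference at receiver `j`. -/
noncomputable def interf (H : Channel (n + 1)) (j : Fin 3) (K : Fin (n + 2)) : Fin (n + 2) → ℂ :=
  Fin.lastCases (motive := fun _ => Fin (n + 2) → ℂ)
    (Matrix.of (H j (j + 1)) *ᵥ chainVec H (j + 1) (Fin.last n))
    (fun k => Matrix.of (H j (j + 2)) *ᵥ chainVec H (j + 2) k) K

theorem interf_castSucc (H : Channel (n + 1)) (j : Fin 3) (k : Fin (n + 1)) :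
    interf H j k.castSucc = Matrix.of (H j (j + 2)) *ᵥ chainVec H (j + 2) k := by
  simp [interf]

theorem interf_succ (H : Channel (n + 1)) (j : Fin 3) (k : Fin (n + 1)) :
    interf H j k.succ = Matrix.of (H j (j + 1)) *ᵥ chainVec H (j + 1) k := by
  induction k using Fin.lastCases with
  | last => simp [interf]
  | cast k => rw [← Fin.castSucc_succ, interf_castSucc, chainVec_align]

/-- Real and imaginary part, as coordinates. -/
noncomputable def part (z : ℂ) : Fin 2 → ℝ := ![z.re, z.im]

/-- The real extended channel, with structured index sets. -/
noncomputable def extChannel (H : Channel (n + 1)) (j i : Fin 3) :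
    Matrix ((Fin (n + 2) × Slot (n + 1)) × Fin 2) ((Fin (n + 1) × Slot (n + 1)) × Fin 2) ℝ :=
  Matrix.of fun a b => if a.1.2 = b.1.2 then
    !![(H j i a.1.1 b.1.1).re, -(H j i a.1.1 b.1.1).im;
      (H j i a.1.1 b.1.1).im, (H j i a.1.1 b.1.1).re] a.2 b.2 else 0

/-- The precoder of transmitter `i`. -/
noncomputable def precoder (H : Channel (n + 1)) (X : Coeffs (n + 1)) (i : Fin 3) :
    Matrix ((Fin (n + 1) × Slot (n + 1)) × Fin 2) (Fin (n + 1) × Option (Slot (n + 1))) ℝ :=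
  Matrix.of fun a b => part (chainVec H i b.1 a.1.1 * X (i - Fin.ofNat 3 b.1) b.2 a.1.2) a.2

/-- The desired and interfering directions seen by receiver `j`. -/
noncomputable def received (H : Channel (n + 1)) (X : Coeffs (n + 1)) (j : Fin 3) :
    Matrix ((Fin (n + 2) × Slot (n + 1)) × Fin 2)
      ((Fin (n + 1) × Option (Slot (n + 1))) ⊕ (Fin (n + 2) × Option (Slot (n + 1)))) ℝ :=
  Matrix.of fun a => Sum.elim
    (fun b => part ((Matrix.of (H j j) *ᵥ chainVec H j b.1) a.1.1 *
      X (j - Fin.ofNat 3 b.1) b.2 a.1.2) a.2)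
    (fun b => part (interf H j b.1 a.1.1 * X (j + 2 - Fin.ofNat 3 b.1) b.2 a.1.2) a.2)

theorem extChannel_mul_precoder (H : Channel (n + 1)) (X : Coeffs (n + 1)) (j i : Fin 3)
    (a : (Fin (n + 2) × Slot (n + 1)) × Fin 2) (b : Fin (n + 1) × Option (Slot (n + 1))) :
    (extChannel H j i * precoder H X i) a b =
      part ((Matrix.of (H j i) *ᵥ chainVec H i b.1) a.1.1 *
        X (i - Fin.ofNat 3 b.1) b.2 a.1.2) a.2 := by
  obtain ⟨⟨q, t⟩, ε⟩ := a
  obtain ⟨k, c⟩ := b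
  simp only [Matrix.mul_apply, extChannel, precoder, Matrix.of_apply, Fintype.sum_prod_type,
    ite_mul, zero_mul]
  have : ∀ r : Fin (n + 1), (∑ t' : Slot (n + 1), ∑ ε' : Fin 2, if t = t' then
      !![(H j i q r).re, -(H j i q r).im; (H j i q r).im, (H j i q r).re] ε ε' *
        part (chainVec H i k r * X (i - Fin.ofNat 3 k) c t') ε' else 0) =
      part (H j i q r * chainVec H i k r * X (i - Fin.ofNat 3 k) c t) ε := by
    intro r
    rw [Finset.sum_eq_single t (by simp +contextual [eq_comm]) (by simp)]
    fin_cases ε <;> simp [part] <;> ring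
  refine (Finset.sum_congr rfl fun r _ => this r).trans ?_
  simp only [Matrix.mulVec, dotProduct, Matrix.of_apply, Finset.sum_mul]
  fin_cases ε <;> simp [part]

theorem exists_leftInverse_of_det_gram_ne_zero {R m n : Type*} [Field R] [Fintype m] [Fintype n]
    [DecidableEq n] {A : Matrix m n R} (h : (Aᵀ * A).det ≠ 0) : ∃ L : Matrix n m R, L * A = 1 :=
  ⟨(Aᵀ * A)⁻¹ * Aᵀ, by
    rw [Matrix.mul_assoc, Matrix.nonsing_inv_mul _ (isUnit_iff_ne_zero.2 h)]⟩

/-- If the received directions are linearly independent at every receiver, zero-forcing filters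
exist. -/
theorem exists_filters (H : Channel (n + 1)) (X : Coeffs (n + 1))
    (hX : ∀ j, ((received H X j)ᵀ * received H X j).det ≠ 0) :
    ∃ W : Fin 3 → Matrix (Fin (n + 1) × Option (Slot (n + 1)))
        ((Fin (n + 2) × Slot (n + 1)) × Fin 2) ℝ,
      (∀ j i, i ≠ j → W j * (extChannel H j i * precoder H X i) = 0) ∧
      ∀ j, W j * (extChannel H j j * precoder H X j) = 1 := by
  choose L hL using fun j => exists_leftInverse_of_det_gram_ne_zero (hX j)
  refine ⟨fun j => (L j).submatrix Sum.inl id, fun j i hij => ?_, fun j => ?_⟩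
  · have hcol : ∀ b, ∃ b', ∀ a, (extChannel H j i * precoder H X i) a b =
        received H X j a (Sum.inr b') := by
      rintro ⟨k, c⟩
      have hi : i = j + 1 ∨ i = j + 2 := by grind
      rcases hi with rfl | rfl
      · refine ⟨(k.succ, c), fun a => ?_⟩
        have e : j + 2 - Fin.ofNat 3 ((k.succ : Fin (n + 2)) : ℕ) = j + 1 - Fin.ofNat 3 (k : ℕ) :=
          add_two_sub_succ j k
        simp only [extChannel_mul_precoder, received, Matrix.of_apply, Sum.elim_inr, interf_succ,
          e]
      · refine ⟨(k.castSucc, c), fun a => ?_⟩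
        simp [extChannel_mul_precoder, received, interf_castSucc]
    ext a b
    obtain ⟨b', hb'⟩ := hcol b
    have := congrFun (congrFun (hL j) (Sum.inl a)) (Sum.inr b')
    simpa [Matrix.mul_apply (m := (Fin (n + 2) × Slot (n + 1)) × Fin 2), hb'] using this
  · ext a b
    have := congrFun (congrFun (hL j) (Sum.inl a)) (Sum.inl b)
    rw [Matrix.mul_apply] at this ⊢
    simpa [extChannel_mul_precoder, received, Matrix.one_apply] using this

section Generic

theorem isLinePoly_kerVec {E : Type*} [TopologicalSpace E] [AddCommGroup E] [Module ℝ E]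
    {m n : Type*} [Fintype m] [DecidableEq m] [Fintype n] {A : E → Matrix m n ℂ}
    (hA : ∀ i j, IsLinePoly fun x => A x i j) (v : n → ℂ) (i : n) :
    IsLinePoly fun x => kerVec (A x) v i := by
  have hA' : ∀ i j, IsLinePoly fun x => (A x)ᴴ i j := fun i j => (hA j i).star
  have hG := IsLinePoly.matrix_mul hA hA'
  exact ((IsLinePoly.det hG).mul (.const (v i))).sub
    (IsLinePoly.mulVec hA' (fun j => IsLinePoly.mulVec (IsLinePoly.adjugate hG)
      (fun k => IsLinePoly.mulVec hA (fun l => .const (v l)) k) j) i)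

theorem isLinePoly_channel (j i : Fin 3) (q : Fin (n + 2)) (r : Fin (n + 1)) :
    IsLinePoly fun z : Channel (n + 1) × Coeffs (n + 1) => z.1 j i q r :=
  IsLinePoly.of_clm ((ContinuousLinearMap.proj (R := ℝ) (φ := fun _ : Fin (n + 1) => ℂ) r).comp
    ((ContinuousLinearMap.proj (R := ℝ) (φ := fun _ : Fin (n + 2) => Fin (n + 1) → ℂ) q).comp
    ((ContinuousLinearMap.proj (R := ℝ)
      (φ := fun _ : Fin 3 => Fin (n + 2) → Fin (n + 1) → ℂ) i).comp
    ((ContinuousLinearMap.proj (R := ℝ)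
      (φ := fun _ : Fin 3 => Fin 3 → Fin (n + 2) → Fin (n + 1) → ℂ) j).comp
    (ContinuousLinearMap.fst ℝ (Channel (n + 1)) (Coeffs (n + 1)))))))

theorem isLinePoly_coeffs (s : Fin 3) (c : Option (Slot (n + 1))) (t : Slot (n + 1)) :
    IsLinePoly fun z : Channel (n + 1) × Coeffs (n + 1) => z.2 s c t :=
  IsLinePoly.of_clm ((ContinuousLinearMap.proj (R := ℝ) (φ := fun _ : Slot (n + 1) => ℂ) t).comp
    ((ContinuousLinearMap.proj (R := ℝ)
      (φ := fun _ : Option (Slot (n + 1)) => Slot (n + 1) → ℂ) c).comp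
    ((ContinuousLinearMap.proj (R := ℝ)
      (φ := fun _ : Fin 3 => Option (Slot (n + 1)) → Slot (n + 1) → ℂ) s).comp
    (ContinuousLinearMap.snd ℝ (Channel (n + 1)) (Coeffs (n + 1))))))

theorem isLinePoly_chainVec (i : Fin 3) (k r : Fin (n + 1)) :
    IsLinePoly fun z : Channel (n + 1) × Coeffs (n + 1) => chainVec z.1 i k r := by
  refine isLinePoly_kerVec (fun a b => ?_) _ _
  simp only [chainMat, Matrix.of_apply]
  refine IsLinePoly.sub ?_ ?_ <;> split_ifs
  exacts [isLinePoly_channel _ _ _ _, .const 0, isLinePoly_channel _ _ _ _, .const 0]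

theorem isLinePoly_channel_mulVec (j i : Fin 3) (k : Fin (n + 1)) (q : Fin (n + 2)) :
    IsLinePoly fun z : Channel (n + 1) × Coeffs (n + 1) =>
      (Matrix.of (z.1 j i) *ᵥ chainVec z.1 i k) q :=
  IsLinePoly.mulVec (fun _ _ => isLinePoly_channel _ _ _ _) (fun _ => isLinePoly_chainVec _ _ _) q

theorem isLinePoly_interf (j : Fin 3) (K q : Fin (n + 2)) :
    IsLinePoly fun z : Channel (n + 1) × Coeffs (n + 1) => interf z.1 j K q := by
  induction K using Fin.lastCases with
  | last => simpa [interf] using isLinePoly_channel_mulVec j (j + 1) (Fin.last n) q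
  | cast k => simpa [interf] using isLinePoly_channel_mulVec j (j + 2) k q

theorem isLinePoly_part {E : Type*} [TopologicalSpace E] [AddCommGroup E] [Module ℝ E]
    {f : E → ℂ} (hf : IsLinePoly f) (ε : Fin 2) : IsLinePoly fun x => (part (f x) ε : ℂ) := by
  fin_cases ε
  exacts [hf.re, hf.im]

theorem isLinePoly_received (j : Fin 3) (a : (Fin (n + 2) × Slot (n + 1)) × Fin 2)
    (b : (Fin (n + 1) × Option (Slot (n + 1))) ⊕ (Fin (n + 2) × Option (Slot (n + 1)))) :
    IsLinePoly fun z : Channel (n + 1) × Coeffs (n + 1) => (received z.1 z.2 j a b : ℂ) := by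
  rcases b with b | b
  · exact isLinePoly_part ((isLinePoly_channel_mulVec _ _ _ _).mul (isLinePoly_coeffs _ _ _)) _
  · exact isLinePoly_part ((isLinePoly_interf _ _ _).mul (isLinePoly_coeffs _ _ _)) _

theorem isLinePoly_det_gram {E : Type*} [TopologicalSpace E] [AddCommGroup E] [Module ℝ E]
    {l m : Type*} [Fintype l] [Fintype m] [DecidableEq m] {A : E → Matrix l m ℝ}
    (hA : ∀ a b, IsLinePoly fun x => (A x a b : ℂ)) :
    IsLinePoly fun x => (((A x)ᵀ * A x).det : ℂ) := by
  have h : ∀ M : Matrix m m ℝ, ((M.det : ℝ) : ℂ) = (M.map (fun x : ℝ => (x : ℂ))).det :=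
    fun M => Complex.ofRealHom.map_det M
  simp only [h]
  refine IsLinePoly.det fun a b => ?_
  simp only [Matrix.map_apply, Matrix.mul_apply, Matrix.transpose_apply, Complex.ofReal_sum,
    Complex.ofReal_mul]
  exact IsLinePoly.sum _ fun c _ => (hA c a).mul (hA c b)

end Generic

section Witness

/-- The scalars relating the paired directions in the witness configuration. -/
noncomputable def ratio {p : ℕ} (k : Fin p) : ℂ := ((k : ℕ) + 2 : ℝ) + Complex.I

/-- A channel realisation in which all alignment chains consist of coordinate vectors. -/
noncomputable def witnessChannel (n : ℕ) : Channel (n + 1) := fun j i q r =>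
  if i = j + 1 then if q = r.succ then 1 else 0
  else if i = j + 2 then if q = r.castSucc then 1 else 0
  else if q = 0 then Complex.I else if q = r.succ then ratio r else 0

theorem witnessChannel_one (j : Fin 3) (q : Fin (n + 2)) (r : Fin (n + 1)) :
    witnessChannel n j (j + 1) q r = if q = r.succ then 1 else 0 := by
  simp [witnessChannel]

theorem witnessChannel_two (j : Fin 3) (q : Fin (n + 2)) (r : Fin (n + 1)) :
    witnessChannel n j (j + 2) q r = if q = r.castSucc then 1 else 0 := by
  simp [witnessChannel]

theorem witnessChannel_self (j : Fin 3) (q : Fin (n + 2)) (r : Fin (n + 1)) :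
    witnessChannel n j j q r =
      if q = 0 then Complex.I else if q = r.succ then ratio r else 0 := by
  have h1 : j ≠ j + 1 := by grind
  have h2 : j ≠ j + 2 := by grind
  simp [witnessChannel, h2]

theorem chainMat_witness (s : Fin 3) (a : Fin n × Fin (n + 2)) (b : Fin (n + 1) × Fin (n + 1)) :
    chainMat (witnessChannel n) s a b =
      (if b.1 = a.1.castSucc then if a.2 = b.2.succ then 1 else 0 else 0) -
      if b.1 = a.1.succ then if a.2 = b.2.castSucc then 1 else 0 else 0 := by
  have e1 := witnessChannel_one (s + Fin.ofNat 3 a.1 + 2) a.2 b.2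
  have e2 := witnessChannel_two (s + Fin.ofNat 3 a.1 + 2) a.2 b.2
  have h1 : s + Fin.ofNat 3 (a.1 : ℕ) + 2 + 1 = s + Fin.ofNat 3 (a.1 : ℕ) := by grind
  have h2 : s + Fin.ofNat 3 (a.1 : ℕ) + 2 + 2 = s + Fin.ofNat 3 (a.1 : ℕ) + 1 := by grind
  rw [h1] at e1
  rw [h2] at e2
  simp only [chainMat, Matrix.of_apply, e1, e2]

theorem chainMat_witness_mulVec (s : Fin 3) :
    chainMat (witnessChannel n) s *ᵥ (fun b => if b.1 = b.2 then 1 else 0) = 0 := by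
  ext ⟨k, q⟩
  simp [Matrix.mulVec, dotProduct, chainMat_witness, Fintype.sum_prod_type,
    Finset.sum_sub_distrib, Fin.castSucc_succ]

theorem chainMat_witness_vecMul_injective (s : Fin 3) :
    Function.Injective fun y => y ᵥ* chainMat (witnessChannel n) s := by
  suffices h : ∀ y, y ᵥ* chainMat (witnessChannel n) s = 0 → y = 0 by
    intro y y' hy
    refine sub_eq_zero.1 (h _ ?_)
    rw [Matrix.sub_vecMul]
    exact sub_eq_zero.2 hy
  intro y hy
  have hcol : ∀ k r : Fin (n + 1), ∑ k', (if k = k'.castSucc then y (k', r.succ) else 0) =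
      ∑ k', (if k = k'.succ then y (k', r.castSucc) else 0) := by
    intro k r
    have := congrFun hy (k, r)
    simp only [Matrix.vecMul, dotProduct, chainMat_witness, Fintype.sum_prod_type, mul_sub,
      Finset.sum_sub_distrib, Pi.zero_apply, sub_eq_zero, mul_ite, mul_one, mul_zero] at this
    convert this using 2 with k' _ k' _
    · split_ifs <;> simp
    · split_ifs <;> simp
  let Y : ℕ → ℕ → ℂ := fun k q => if h : k < n ∧ q < n + 2 then y (⟨k, h.1⟩, ⟨q, h.2⟩) else 0
  have hY1 : ∀ k r : Fin (n + 1),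
      ∑ k', (if k = k'.castSucc then y (k', r.succ) else 0) = Y k (r + 1) := by
    intro k r
    induction k using Fin.lastCases with
    | last => simp [Y, (Fin.castSucc_ne_last _).symm]
    | cast k =>
      simp [Y, show (r : ℕ) < n + 1 from r.2, Fin.succ]
  have hzero : ∀ r, r ≤ n → Y 0 (r + 1) = 0 := by
    intro r hr
    have := hcol 0 ⟨r, by omega⟩
    rw [hY1] at this
    simpa [(Fin.succ_ne_zero _).symm] using this
  have hsucc : ∀ k r, k < n → r ≤ n → Y (k + 1) (r + 1) = Y k r := by
    intro k r hk hr
    have := hcol (Fin.succ ⟨k, hk⟩) ⟨r, by omega⟩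
    rw [hY1] at this
    simp only [Fin.succ_inj, Finset.sum_ite_eq, Finset.mem_univ, if_true] at this
    exact this.trans (by simp [Y, hk, show r < n + 2 by omega])
  have hup : ∀ k q, k < q → q ≤ n + 1 → k ≤ n → Y k q = 0 := by
    intro k
    induction k with
    | zero =>
      intro q hq hqn _
      obtain ⟨r, rfl⟩ := Nat.exists_eq_succ_of_ne_zero hq.ne'
      exact hzero r (by omega)
    | succ k ih =>
      intro q hq hqn hk
      obtain ⟨r, rfl⟩ := Nat.exists_eq_succ_of_ne_zero (by omega : q ≠ 0)
      exact (hsucc k r (by omega) (by omega)).trans (ih r (by omega) (by omega) (by omega))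
  have hdown : ∀ m k q, k + m = n → q ≤ k → Y k q = 0 := by
    intro m
    induction m with
    | zero =>
      intro k q hk _
      simp [Y, show ¬ k < n by omega]
    | succ m ih =>
      intro k q hk hq
      rw [← hsucc k q (by omega) (by omega)]
      exact ih (k + 1) (q + 1) (by omega) (by omega)
  ext ⟨k, q⟩
  have : Y k q = y (k, q) := by simp [Y]
  rw [← this, Pi.zero_apply]
  rcases lt_or_ge (k : ℕ) q with h | h
  · exact hup _ _ h (by omega) (by omega)
  · exact hdown (n - k) _ _ (by omega) h

/-- The scaling factor of the witness chain. -/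
noncomputable def witnessScale (n : ℕ) (s : Fin 3) : ℂ :=
  (chainMat (witnessChannel n) s * (chainMat (witnessChannel n) s)ᴴ).det

open scoped ComplexOrder in
theorem witnessScale_ne_zero (s : Fin 3) : witnessScale n s ≠ 0 :=
  (Matrix.PosDef.mul_conjTranspose_self _ (chainMat_witness_vecMul_injective s)).det_pos.ne'

theorem chainVec_witness (i : Fin 3) (k r : Fin (n + 1)) :
    chainVec (witnessChannel n) i k r =
      witnessScale n (i - Fin.ofNat 3 k) * if k = r then 1 else 0 := by
  rw [chainVec, kerVec_of_mulVec_eq_zero (chainMat_witness_mulVec _)]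
  rfl

theorem witness_mulVec (j i : Fin 3) (k : Fin (n + 1)) (q : Fin (n + 2)) :
    (Matrix.of (witnessChannel n j i) *ᵥ chainVec (witnessChannel n) i k) q =
      witnessScale n (i - Fin.ofNat 3 k) * witnessChannel n j i q k := by
  simp [Matrix.mulVec, dotProduct, chainVec_witness, mul_comm]

theorem interf_witness (j : Fin 3) (K q : Fin (n + 2)) :
    interf (witnessChannel n) j K q =
      witnessScale n (j + 2 - Fin.ofNat 3 K) * if q = K then 1 else 0 := by
  induction K using Fin.cases with
  | zero =>
    rw [← Fin.castSucc_zero, interf_castSucc, witness_mulVec, witnessChannel_two]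
    rfl
  | succ k =>
    have e : j + 2 - Fin.ofNat 3 ((k.succ : Fin (n + 2)) : ℕ) = j + 1 - Fin.ofNat 3 (k : ℕ) :=
      add_two_sub_succ j k
    rw [interf_succ, witness_mulVec, witnessChannel_one, e]

end Witness

section Core

variable {p : ℕ}

/-- The family of chains for which a slot carries the extra, non-aligned direction. -/
def slotColor (j : Fin 3) : Slot p → Fin 3
  | none => j + 2
  | some (l, false) => j - Fin.ofNat 3 l
  | some (l, true) => j + 1 - Fin.ofNat 3 l

/-- The direction of the real line used by the chains of family `s` in a given slot. -/
noncomputable def slotLine (j s : Fin 3) : Slot p → ℂ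
  | none => 1
  | some (l, _) => if s = j - Fin.ofNat 3 l then 1
    else if s = j + 1 - Fin.ofNat 3 l then ratio l else 1 - Complex.I

theorem eq_zero_of_slotLine {j : Fin 3} {k l : Fin p} (hkl : k ≠ l) {b : Bool} {x y : ℝ}
    (h : y * slotLine j (j + 1 - Fin.ofNat 3 k) (some (l, b)) +
      ratio k * (x * slotLine j (j - Fin.ofNat 3 k) (some (l, b))) = 0) : x = 0 ∧ y = 0 := by
  have hkl' : ((k : ℕ) : ℝ) - ((l : ℕ) : ℝ) ≠ 0 :=
    sub_ne_zero.2 fun h => hkl (Fin.ext (by exact_mod_cast h))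
  have hk : (0 : ℝ) ≤ ((k : ℕ) : ℝ) := Nat.cast_nonneg _
  have hl : (0 : ℝ) ≤ ((l : ℕ) : ℝ) := Nat.cast_nonneg _
  generalize Fin.ofNat 3 (k : ℕ) = κ at h
  generalize hL : Fin.ofNat 3 (l : ℕ) = L
  simp only [slotLine, hL] at h
  have h3 : κ = L ∨ κ = L + 2 ∨ κ = L + 1 := by grind
  rcases h3 with rfl | rfl | rfl
  · have h1 : j + 1 - κ ≠ j - κ := by grind
    simp [h1, ratio, Complex.ext_iff] at h
    obtain ⟨hre, him⟩ := h
    have : x * (((k : ℕ) : ℝ) - ((l : ℕ) : ℝ)) = 0 := by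
      linear_combination hre - ((l : ℕ) + 2 : ℝ) * him
    have hx : x = 0 := (mul_eq_zero.1 this).resolve_right hkl'
    exact ⟨hx, by simpa [hx] using him⟩
  · have h1 : j + 1 - (L + 2) ≠ j - L := by grind
    have h2 : j + 1 - (L + 2) ≠ j + 1 - L := by grind
    have h4 : j - (L + 2) ≠ j - L := by grind
    have h5 : j - (L + 2) = j + 1 - L := by grind
    simp [h1, h2, h5, ratio, Complex.ext_iff] at h
    obtain ⟨hre, him⟩ := h
    have hx : x * (((k : ℕ) + 2 : ℝ) * ((l : ℕ) + 2) + (k : ℕ) + (l : ℕ) + 3) = 0 := by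
      linear_combination hre + him
    have hx : x = 0 := (mul_eq_zero.1 hx).resolve_right (by positivity)
    exact ⟨hx, by simpa [hx] using hre⟩
  · have h1 : j + 1 - (L + 1) = j - L := by grind
    have h4 : j - (L + 1) ≠ j - L := by grind
    have h5 : j - (L + 1) ≠ j + 1 - L := by grind
    simp [h1, h4, h5, ratio, Complex.ext_iff] at h
    obtain ⟨hre, him⟩ := h
    have hx : x * (((k : ℕ) : ℝ) + 1) = 0 := by linear_combination -him
    have hx : x = 0 := (mul_eq_zero.1 hx).resolve_right (by positivity)
    exact ⟨hx, by simpa [hx] using hre⟩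

theorem eq_zero_of_slotLine_none {j : Fin 3} {k : Fin p} {s s' : Fin 3} {x y : ℝ}
    (h : (y : ℂ) * slotLine (p := p) j s none + ratio k * (x * slotLine (p := p) j s' none) = 0) :
    x = 0 ∧ y = 0 := by
  simp [slotLine, ratio, Complex.ext_iff] at h
  obtain ⟨hre, rfl⟩ := h
  simpa using hre

theorem eq_zero_of_slotLine_center {j : Fin 3} {s : Fin 3} {t : Fin p × Bool} {x y : ℝ}
    (h : (y : ℂ) * slotLine (p := p) j s (some t) + Complex.I * x = 0) : x = 0 := by
  obtain ⟨l, b⟩ := t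
  have hl : (0 : ℝ) ≤ ((l : ℕ) : ℝ) := Nat.cast_nonneg _
  simp only [slotLine] at h
  split_ifs at h <;> simp [ratio, Complex.ext_iff] at h
  · exact h.2
  · have : y = 0 := h.1.resolve_right (by positivity)
    simpa [this] using h.2
  · simpa [h.1] using h.2

/-- The direction `c` of the coefficient vectors in family `s`, before scaling. -/
noncomputable def direction (j s : Fin 3) (c : Option (Slot p)) (t : Slot p) : ℂ :=
  c.elim (if slotColor j t = s then Complex.I * slotLine j s t else 0)
    fun t' => if t' = t then slotLine j s t else 0

theorem sum_direction (j s : Fin 3) (v : Option (Slot p) → ℝ) (t : Slot p) :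
    ∑ c, (v c : ℂ) * direction j s c t =
      (v (some t) + if slotColor j t = s then Complex.I * v none else 0) * slotLine j s t := by
  rw [Fintype.sum_option]
  simp only [direction, Option.elim, mul_ite, mul_zero, Finset.sum_ite_eq', Finset.mem_univ,
    if_true]
  split_ifs <;> ring

theorem coeff_eq_zero (j : Fin 3) (v : Fin p → Option (Slot p) → ℝ)
    (w : Fin (p + 1) → Option (Slot p) → ℝ)
    (hpair : ∀ (k : Fin p) t, ∑ c, (w k.succ c : ℂ) * direction j (j + 1 - Fin.ofNat 3 k) c t +
      ratio k * ∑ c, (v k c : ℂ) * direction j (j - Fin.ofNat 3 k) c t = 0)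
    (hcenter : ∀ t, ∑ c, (w 0 c : ℂ) * direction j (j + 2) c t +
      Complex.I * ∑ k, ∑ c, (v k c : ℂ) * direction j (j - Fin.ofNat 3 k) c t = 0) :
    v = 0 ∧ w = 0 := by
  simp only [sum_direction] at hpair hcenter
  have hratio : ∀ k : Fin p, ratio k ≠ 0 := fun k h => by
    simpa [ratio] using congrArg Complex.im h
  have hne : ∀ κ : Fin 3, j + 1 - κ ≠ j - κ := by grind
  have hv : ∀ k, v k none = 0 := by
    intro k
    have h := hpair k (some (k, false))
    simp only [slotColor, slotLine, hne, (hne _).symm, if_true, if_false] at h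
    have h' : ratio k * (w k.succ (some (some (k, false))) + v k (some (some (k, false))) +
      Complex.I * v k none) = 0 := by linear_combination h
    simpa using congrArg Complex.im ((mul_eq_zero.1 h').resolve_left (hratio k))
  have hw : ∀ k : Fin p, w k.succ none = 0 := by
    intro k
    have h := hpair k (some (k, true))
    simp only [slotColor, slotLine, hne, (hne _).symm, if_true, if_false] at h
    have h' : ratio k * (w k.succ (some (some (k, true))) + v k (some (some (k, true))) +
      Complex.I * w k.succ none) = 0 := by linear_combination h
    simpa using congrArg Complex.im ((mul_eq_zero.1 h').resolve_left (hratio k))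
  simp only [hv, hw, Complex.ofReal_zero, mul_zero, ite_self, add_zero] at hpair hcenter
  have hnone : ∀ k, v k (some none) = 0 ∧ w k.succ (some none) = 0 :=
    fun k => eq_zero_of_slotLine_none (hpair k none)
  have hother : ∀ k l b, k ≠ l →
      v k (some (some (l, b))) = 0 ∧ w k.succ (some (some (l, b))) = 0 :=
    fun k l b hkl => eq_zero_of_slotLine hkl (hpair k (some (l, b)))
  have hcenter_none := hcenter none
  simp [slotColor, slotLine, hnone, Complex.ext_iff] at hcenter_none
  simp only [hcenter_none.2, Complex.ofReal_zero, mul_zero, ite_self, add_zero] at hcenter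
  have hsingle : ∀ k b, (w 0 (some (some (k, b))) : ℂ) * slotLine j (j + 2) (some (k, b)) +
      Complex.I * v k (some (some (k, b))) = 0 := by
    intro k b
    have h := hcenter (some (k, b))
    rw [Finset.sum_eq_single k (fun k' _ hk => by simp [(hother k' k b hk).1]) (by simp)] at h
    simpa [slotLine] using h
  have hself : ∀ k b, v k (some (some (k, b))) = 0 :=
    fun k b => eq_zero_of_slotLine_center (hsingle k b)
  have hv0 : v = 0 := by
    ext k c
    rcases c with _ | _ | ⟨l, b⟩
    · exact hv k
    · exact (hnone k).1
    · by_cases h : k = l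
      · exact h ▸ hself k b
      · exact (hother k l b h).1
  have hline : ∀ s (t : Slot p), slotLine j s t ≠ 0 := by
    intro s t
    rcases t with _ | ⟨l, b⟩
    · simp [slotLine]
    · simp only [slotLine]
      split_ifs
      · exact one_ne_zero
      · exact hratio l
      · simp [Complex.ext_iff]
  refine ⟨hv0, ?_⟩
  subst hv0
  ext K c
  induction K using Fin.cases with
  | zero =>
    rcases c with _ | t
    · exact hcenter_none.2
    · simpa [hline] using hcenter t
  | succ k =>
    rcases c with _ | t
    · exact hw k
    · simpa [hline] using hpair k t

end Core

section Generic

theorem det_gram_ne_zero_of_mulVec {m n : Type*} [Fintype m] [Fintype n] [DecidableEq n]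
    {A : Matrix m n ℝ} (h : ∀ v, A *ᵥ v = 0 → v = 0) : (Aᵀ * A).det ≠ 0 := by
  have hinj : Function.Injective A.mulVec := by
    intro v v' hv
    refine sub_eq_zero.1 (h _ ?_)
    rw [Matrix.mulVec_sub]
    exact sub_eq_zero.2 hv
  have := (Matrix.PosDef.conjTranspose_mul_self A hinj).det_pos.ne'
  rwa [Matrix.conjTranspose_eq_transpose_of_trivial] at this

theorem eq_zero_of_part {z : ℂ} (h : ∀ ε, part z ε = 0) : z = 0 :=
  Complex.ext (h 0) (h 1)

theorem part_sum {ι : Type*} (s : Finset ι) (f : ι → ℂ) (ε : Fin 2) :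
    part (∑ i ∈ s, f i) ε = ∑ i ∈ s, part (f i) ε := by
  fin_cases ε <;> simp [part]

theorem part_add (z w : ℂ) (ε : Fin 2) : part (z + w) ε = part z ε + part w ε := by
  fin_cases ε <;> simp [part]

theorem part_ofReal_mul (x : ℝ) (z : ℂ) (ε : Fin 2) : part (x * z) ε = x * part z ε := by
  fin_cases ε <;> simp [part]

theorem received_mulVec (H : Channel (n + 1)) (X : Coeffs (n + 1)) (j : Fin 3)
    (v : (Fin (n + 1) × Option (Slot (n + 1))) ⊕ (Fin (n + 2) × Option (Slot (n + 1))) → ℝ)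
    (q : Fin (n + 2)) (t : Slot (n + 1)) (ε : Fin 2) :
    (received H X j *ᵥ v) ((q, t), ε) =
      part ((∑ k, ∑ c, (v (Sum.inl (k, c)) : ℂ) * ((Matrix.of (H j j) *ᵥ chainVec H j k) q *
        X (j - Fin.ofNat 3 k) c t)) +
      ∑ K, ∑ c, (v (Sum.inr (K, c)) : ℂ) * (interf H j K q *
        X (j + 2 - Fin.ofNat 3 K) c t)) ε := by
  simp only [part_add, part_sum, part_ofReal_mul]
  simp only [Matrix.mulVec, dotProduct, received, Matrix.of_apply, Fintype.sum_sum_type,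
    Fintype.sum_prod_type, Sum.elim_inl, Sum.elim_inr]
  congr 1 <;> exact Finset.sum_congr rfl fun _ _ => Finset.sum_congr rfl fun _ _ => mul_comm _ _

end Generic

section Measure

variable {α β γ δ : Type*} [Fintype α] [Fintype β] [Fintype γ] [Fintype δ]

instance borelSpace_pi_pi : BorelSpace (α → β → ℂ) :=
  Pi.borelSpace (X := fun _ : α => β → ℂ)

instance borelSpace_pi_pi_pi : BorelSpace (α → β → γ → ℂ) :=
  Pi.borelSpace (X := fun _ : α => β → γ → ℂ)

instance borelSpace_pi_pi_pi_pi : BorelSpace (α → β → γ → δ → ℂ) :=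
  Pi.borelSpace (X := fun _ : α => β → γ → δ → ℂ)

instance sigmaFinite_pi_pi : SigmaFinite (volume : Measure (α → β → ℂ)) :=
  Measure.pi.sigmaFinite fun _ : α => (volume : Measure (β → ℂ))

instance sigmaFinite_pi_pi_pi : SigmaFinite (volume : Measure (α → β → γ → ℂ)) :=
  Measure.pi.sigmaFinite fun _ : α => (volume : Measure (β → γ → ℂ))

instance sigmaFinite_pi_pi_pi_pi : SigmaFinite (volume : Measure (α → β → γ → δ → ℂ)) :=
  Measure.pi.sigmaFinite fun _ : α => (volume : Measure (β → γ → δ → ℂ))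

instance isAddHaarMeasure_pi_pi : (volume : Measure (α → β → ℂ)).IsAddHaarMeasure :=
  Measure.pi.isAddHaarMeasure fun _ : α => (volume : Measure (β → ℂ))

instance isAddHaarMeasure_pi_pi_pi : (volume : Measure (α → β → γ → ℂ)).IsAddHaarMeasure :=
  Measure.pi.isAddHaarMeasure fun _ : α => (volume : Measure (β → γ → ℂ))

instance isAddHaarMeasure_pi_pi_pi_pi :
    (volume : Measure (α → β → γ → δ → ℂ)).IsAddHaarMeasure :=
  Measure.pi.isAddHaarMeasure fun _ : α => (volume : Measure (β → γ → δ → ℂ))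

end Measure

section Genericity

/-- Coefficient vectors making the received directions of the witness channel independent. -/
noncomputable def witnessCoeffs (n : ℕ) (j : Fin 3) : Coeffs (n + 1) := fun s c t =>
  (witnessScale n s)⁻¹ * direction j s c t

theorem received_witness_mulVec_eq_zero (j : Fin 3)
    (v : (Fin (n + 1) × Option (Slot (n + 1))) ⊕ (Fin (n + 2) × Option (Slot (n + 1))) → ℝ)
    (h : received (witnessChannel n) (witnessCoeffs n j) j *ᵥ v = 0) : v = 0 := by
  have hX : ∀ s c t (z : ℂ), witnessScale n s * z * witnessCoeffs n j s c t =
      z * direction j s c t := fun s c t z => by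
    rw [witnessCoeffs]
    field_simp [witnessScale_ne_zero s]
  have key : ∀ q t, (∑ k, ∑ c, (v (Sum.inl (k, c)) : ℂ) *
        (witnessChannel n j j q k * direction j (j - Fin.ofNat 3 k) c t)) +
      ∑ c, (v (Sum.inr (q, c)) : ℂ) * direction j (j + 2 - Fin.ofNat 3 q) c t = 0 := by
    intro q t
    refine eq_zero_of_part fun ε => ?_
    have hq := congrFun h ((q, t), ε)
    rw [received_mulVec] at hq
    simp only [witness_mulVec, interf_witness, hX] at hq
    rw [Finset.sum_eq_single q (fun K _ hK => by simp [hK.symm]) (by simp)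
      (f := fun K => ∑ c, (v (Sum.inr (K, c)) : ℂ) * ((if q = K then 1 else 0) *
        direction j (j + 2 - Fin.ofNat 3 K) c t))] at hq
    simpa using hq
  obtain ⟨h1, h2⟩ := coeff_eq_zero j (fun k c => v (Sum.inl (k, c)))
    (fun K c => v (Sum.inr (K, c)))
    (fun k t => by
      have := key k.succ t
      have e : j + 2 - Fin.ofNat 3 ((k.succ : Fin (n + 2)) : ℕ) = j + 1 - Fin.ofNat 3 (k : ℕ) :=
        add_two_sub_succ j k
      rw [Finset.sum_eq_single k (fun k' _ hk => by simp [witnessChannel_self, hk.symm])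
        (by simp), e, add_comm] at this
      simpa [witnessChannel_self, Finset.mul_sum, mul_left_comm, -Fintype.sum_option] using this)
    (fun t => by
      have := key 0 t
      rw [add_comm] at this
      simpa [witnessChannel_self, Finset.mul_sum, mul_left_comm, -Fintype.sum_option] using this)
  ext b
  rcases b with ⟨k, c⟩ | ⟨K, c⟩
  · exact congrFun (congrFun h1 k) c
  · exact congrFun (congrFun h2 K) c

theorem ae_exists_coeffs (n : ℕ) : ∀ᵐ H ∂(volume : Measure (Channel (n + 1))),
    ∃ X : Coeffs (n + 1), ∀ j, ((received H X j)ᵀ * received H X j).det ≠ 0 := by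
  have : ((volume : Measure (Channel (n + 1))).prod
      (volume : Measure (Coeffs (n + 1)))).IsAddHaarMeasure :=
    Measure.prod.instIsAddHaarMeasure _ _
  have h : ∀ᵐ z ∂((volume : Measure (Channel (n + 1))).prod
      (volume : Measure (Coeffs (n + 1)))),
      ∀ j, ((received z.1 z.2 j)ᵀ * received z.1 z.2 j).det ≠ 0 := by
    refine ae_all_iff.2 fun j => ?_
    have hw := det_gram_ne_zero_of_mulVec (received_witness_mulVec_eq_zero (n := n) j)
    have := (isLinePoly_det_gram (isLinePoly_received (n := n) j)).ae_ne_zero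
      ((volume : Measure (Channel (n + 1))).prod (volume : Measure (Coeffs (n + 1))))
      (a := (witnessChannel n, witnessCoeffs n j)) (by exact_mod_cast hw)
    filter_upwards [this] with z hz
    exact_mod_cast hz
  filter_upwards [Measure.ae_ae_of_ae_prod h] with H hH
  exact hH.exists

end Genericity

section Reindexing

/-- Splitting a symbol-extended index into antenna, time slot and real or imaginary part. -/
noncomputable def extEquiv (n m : ℕ) :
    Fin (m * (2 * (2 * (n + 1) + 1))) ≃ (Fin m × Slot (n + 1)) × Fin 2 :=
  (finProdFinEquiv.symm.trans (Equiv.prodCongr (Equiv.refl _)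
    ((finCongr (mul_comm _ _)).trans (finProdFinEquiv.symm.trans (Equiv.prodCongr
      (Fintype.equivOfCardEq (by simp; ring)) (Equiv.refl (Fin 2))))))).trans
    (Equiv.prodAssoc _ _ _).symm

theorem Hext_eq_submatrix (H : Channel (n + 1)) (j i : Fin 3) :
    Hext (n + 1) H j i = (extChannel H j i).submatrix (extEquiv n (n + 2)) (extEquiv n (n + 1)) := by
  ext a b
  simp [Hext, blk, Cmat, extChannel, extEquiv, finProdFinEquiv, Fin.ext_iff, Fin.divNat, Fin.modNat]

theorem ae_exists_precoders (n : ℕ) :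
    ∀ᵐ H ∂(volume : Measure (Channel (n + 1))),
      ∃ (V : Fin 3 → Matrix (Fin ((n + 1) * (2 * (2 * (n + 1) + 1))))
          (Fin (2 * (n + 1) * (n + 1 + 1))) ℝ)
        (W : Fin 3 → Matrix (Fin (2 * (n + 1) * (n + 1 + 1)))
          (Fin ((n + 1 + 1) * (2 * (2 * (n + 1) + 1)))) ℝ),
        (∀ j i, i ≠ j → W j * Hext (n + 1) H j i * V i = 0) ∧
        ∀ j, IsUnit (W j * Hext (n + 1) H j j * V j) := by
  filter_upwards [ae_exists_coeffs n] with H ⟨X, hX⟩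
  obtain ⟨W, hW0, hW1⟩ := exists_filters H X hX
  have e : Fin (2 * (n + 1) * (n + 1 + 1)) ≃ Fin (n + 1) × Option (Slot (n + 1)) :=
    Fintype.equivOfCardEq (by simp; ring)
  have key : ∀ j i, (W j).submatrix e (extEquiv n (n + 2)) * Hext (n + 1) H j i *
      (precoder H X i).submatrix (extEquiv n (n + 1)) e =
      (W j * (extChannel H j i * precoder H X i)).submatrix e e := by
    intro j i
    rw [Hext_eq_submatrix, Matrix.mul_assoc, Matrix.submatrix_mul_equiv,
      Matrix.submatrix_mul_equiv]
  refine ⟨fun i => (precoder H X i).submatrix (extEquiv n (n + 1)) e,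
    fun j => (W j).submatrix e (extEquiv n (n + 2)), fun j i hij => ?_, fun j => ?_⟩
  · rw [key, hW0 j i hij, Matrix.submatrix_zero]
    rfl
  · rw [key, hW1, Matrix.submatrix_one_equiv]
    exact isUnit_one

end Reindexing

end MIMO

/-- Achievability part of Theorem 2 of the paper: for `p ∈ {3,4,5,6}` and Lebesgue-almost
every tuple of nine complex `(p+1)×p` channel matrices `H̄_{j,i}` of the 3-user (p,p+1)
MIMO IC, with `T = 2p+1` symbol extensions and asymmetric complex signaling there are
linear precoders `V_i ∈ ℝ^{2Tp × 2p(p+1)}` and receive filters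
`W_j ∈ ℝ^{2p(p+1) × 2T(p+1)}` that zero-force all interference while keeping
`W_j H_{j,j} V_j` invertible, i.e. each user achieves `p(p+1)/(2p+1)` degrees of freedom. -/
theorem dof_achievability_p (p : ℕ) (hp : p = 3 ∨ p = 4 ∨ p = 5 ∨ p = 6) :
    ∀ᵐ H ∂(volume : Measure (Fin 3 → Fin 3 → Fin (p + 1) → Fin p → ℂ)),
      ∃ (V : Fin 3 → Matrix (Fin (p * (2 * (2 * p + 1)))) (Fin (2 * p * (p + 1))) ℝ)
        (W : Fin 3 → Matrix (Fin (2 * p * (p + 1))) (Fin ((p + 1) * (2 * (2 * p + 1)))) ℝ),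
        (∀ j i, i ≠ j → W j * Hext p H j i * V i = 0) ∧
        ∀ j, IsUnit (W j * Hext p H j j * V j) := by
  obtain ⟨n, rfl⟩ : ∃ n, p = n + 1 := ⟨p - 1, by omega⟩
  exact MIMO.ae_exists_precoders n
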